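/- arXiv:1608.06013 — 2 statements merged into one kernel-verified Lean document; each statement's English description precedes it below -/
import Mathlib

section
/- If M is an internally 4-connected binary matroid and e is an element of M, then si(M/e) is 3-connected. -/
open Set Matroid

namespace Paper

variable {α : Type*}

/-- A circuit of a matroid: a minimal dependent set. -/
def Circuit (M : Matroid α) (C : Set α) : Prop :=
  C ⊆ M.E ∧ ¬ M.Indep C ∧ ∀ D, D ⊂ C → M.Indep D

/-- A cocircuit: a circuit of the dual matroid. -/
def Cocircuit (M : Matroid α) (C : Set α) : Prop := Circuit M✶ C

/-- A triangle: a 3-element circuit. -/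
def IsTriangle (M : Matroid α) (T : Set α) : Prop := Circuit M T ∧ T.encard = 3

/-- A triad: a 3-element cocircuit. -/
def IsTriad (M : Matroid α) (T : Set α) : Prop := Cocircuit M T ∧ T.encard = 3

/-- The (extended) rank of a set: the supremum of the cardinalities of
independent subsets. -/
noncomputable def eRank (M : Matroid α) (X : Set α) : ℕ∞ :=
  ⨆ I ∈ {I : Set α | M.Indep I ∧ I ⊆ X}, I.encard

/-- The rank of the matroid. -/
noncomputable def eRk (M : Matroid α) : ℕ∞ := eRank M M.E

/-- `(X, Y)` is a `k`-separation of `M`: a partition of the ground set into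
two sets, each of size at least `k`, with `λ(X) = r(X) + r(Y) - r(M) ≤ k - 1`. -/
def IsKSeparation (M : Matroid α) (k : ℕ) (X Y : Set α) : Prop :=
  Disjoint X Y ∧ X ∪ Y = M.E ∧
    eRank M X + eRank M Y ≤ eRk M + ((k - 1 : ℕ) : ℕ∞) ∧
    (k : ℕ∞) ≤ X.encard ∧ (k : ℕ∞) ≤ Y.encard

/-- `M` is `n`-connected if it has no `k`-separation for any positive `k < n`. -/
def NConnected (M : Matroid α) (n : ℕ) : Prop :=
  ∀ k, 1 ≤ k → k < n → ∀ X Y, ¬ IsKSeparation M k X Y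

/-- `M` is internally 4-connected if it is 3-connected and every
3-separation has a side that is a triangle or a triad. -/
def InternallyFourConnected (M : Matroid α) : Prop :=
  NConnected M 3 ∧ ∀ X Y, IsKSeparation M 3 X Y →
    IsTriangle M X ∨ IsTriad M X ∨ IsTriangle M Y ∨ IsTriad M Y

/-- `M` is binary: representable over `GF(2)`. -/
def Binary (M : Matroid α) : Prop :=
  ∃ φ : α → (α →₀ ZMod 2), ∀ I, I ⊆ M.E →
    (M.Indep I ↔ LinearIndependent (ZMod 2) (fun x : I => φ x.1))

/-- Every element of `M` is in exactly three triangles. -/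
def EveryElementInThreeTriangles (M : Matroid α) : Prop :=
  ∀ e ∈ M.E, {T : Set α | IsTriangle M T ∧ e ∈ T}.encard = 3

/-- Deletion of a set of elements. -/
def delete (M : Matroid α) (D : Set α) : Matroid α := M ↾ (M.E \ D)

/-- Contraction of a set of elements. -/
def contract (M : Matroid α) (C : Set α) : Matroid α := (delete M✶ C)✶

/-- A nonloop. -/
def Nonloop (M : Matroid α) (e : α) : Prop := M.Indep {e}

/-- `N` is a simplification of `M`: the restriction of `M` to a set of
nonloops containing exactly one element from each parallel class. -/
def IsSimplificationOf (N M : Matroid α) : Prop :=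
  ∃ S, S ⊆ M.E ∧ N = M ↾ S ∧ (∀ e ∈ S, Nonloop M e) ∧
    ∀ f, Nonloop M f → ∃! e, e ∈ S ∧ M.closure {e} = M.closure {f}

/-- `si(M/e)` is internally 4-connected. -/
def SiContractI4C (M : Matroid α) (e : α) : Prop :=
  ∀ N, IsSimplificationOf N (contract M {e}) → InternallyFourConnected N

/-- A set is fully closed if it is closed in `M` and in `M✶`. -/
def FullyClosed (M : Matroid α) (F : Set α) : Prop :=
  M.closure F = F ∧ M✶.closure F = F

/-- The full closure of a set: the intersection of all fully closed sets
containing it. -/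
def fcl (M : Matroid α) (Z : Set α) : Set α := ⋂₀ {F | Z ⊆ F ∧ FullyClosed M F}

/-- An exact 4-separation: a 4-separation with `λ = 3`. -/
def IsExact4Separation (M : Matroid α) (X Y : Set α) : Prop :=
  Disjoint X Y ∧ X ∪ Y = M.E ∧
    eRank M X + eRank M Y = eRk M + 3 ∧
    (4 : ℕ∞) ≤ X.encard ∧ (4 : ℕ∞) ≤ Y.encard



lemma eRank_eq (M : Matroid α) (X : Set α) : eRank M X = M.eRk X := by
  apply le_antisymm
  · refine iSup₂_le fun I hI => hI.1.encard_le_eRk_of_subset hI.2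
  · obtain ⟨I, hI⟩ := M.exists_isBasis' X
    rw [← hI.encard_eq_eRk]
    exact le_iSup₂_of_le I ⟨hI.indep, hI.subset⟩ le_rfl

lemma eRk_eq (M : Matroid α) : eRk M = M.eRk M.E := eRank_eq M M.E

lemma contract_rk (M : Matroid α) (e : α) (he : M.Indep {e}) (X : Set α)
    (hX : X ⊆ M.E) (heX : e ∉ X) :
    (M ／ {e}).eRk X + 1 = M.eRk (insert e X) := by
  have hX' : X ⊆ (M ／ {e}).E := by
    rw [contract_ground]; exact subset_sdiff.2 ⟨hX, by simpa using heX⟩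
  obtain ⟨I, hI⟩ := (M ／ {e}).exists_isBasis X
  have h := he.union_isBasis_union_of_contract_isBasis hI
  have heI : e ∉ I := fun h => heX (hI.subset h)
  have h1 := h.encard_eq_eRk
  rw [← hI.encard_eq_eRk, ← union_singleton, ← h1, union_singleton, encard_insert_of_notMem heI]

lemma bin_closure (M : Matroid α) (φ : α → (α →₀ ZMod 2)) (h : ∀ I, I ⊆ M.E →
    (M.Indep I ↔ LinearIndependent (ZMod 2) (fun x : I => φ x.1)))
    (X : Set α) (hX : X ⊆ M.E) (x : α) (hx : x ∈ M.E) :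
    x ∈ M.closure X ↔ φ x ∈ Submodule.span (ZMod 2) (φ '' X) := by
  have key : ∀ J, M.Indep J → ∀ x ∈ M.E,
      (x ∈ M.closure J ↔ φ x ∈ Submodule.span (ZMod 2) (φ '' J)) := by
    intro J hJ x hx
    have hJE := hJ.subset_ground
    by_cases hxJ : x ∈ J
    · exact ⟨fun _ => Submodule.subset_span (mem_image_of_mem _ hxJ),
        fun _ => M.mem_closure_of_mem hxJ⟩
    · have h1 : M.Indep (insert x J) ↔ LinearIndepOn (ZMod 2) φ (insert x J) :=
        h _ (insert_subset hx hJE)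
      have h2 : LinearIndepOn (ZMod 2) φ J := (h _ hJE).1 hJ
      rw [linearIndepOn_insert hxJ, and_iff_right h2] at h1
      have h3 := hJ.notMem_closure_iff_of_notMem hxJ hx
      rw [h1] at h3
      exact not_iff_not.1 h3
  obtain ⟨J, hJ⟩ := M.exists_isBasis X
  rw [← hJ.closure_eq_closure, key J hJ.indep x hx]
  have : Submodule.span (ZMod 2) (φ '' J) = Submodule.span (ZMod 2) (φ '' X) := by
    apply le_antisymm
    · exact Submodule.span_mono (image_mono hJ.subset)
    · rw [Submodule.span_le]
      rintro _ ⟨y, hy, rfl⟩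
      exact (key J hJ.indep y (hX hy)).1 (hJ.subset_closure hy)
  rw [this]

lemma z2 (l : ZMod 2) : l = 0 ∨ l = 1 := by
  revert l; decide

lemma binary_core (M : Matroid α) (hB : Binary M) (a b c e : α) (W : Set α)
    (haE : a ∈ M.E) (hbE : b ∈ M.E) (hcE : c ∈ M.E) (hWE : W ⊆ M.E) (heW : e ∈ W)
    (hb : b ∉ M.closure W) (hc : c ∉ M.closure W)
    (hba : b ∈ M.closure (insert a W)) (habc : c ∈ M.closure {a, b, e})
    (hac : c ∉ M.closure {a, e}) (hbc : c ∉ M.closure {b, e}) : False := by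
  obtain ⟨φ, hφ⟩ := hB
  have heE := hWE heW
  have cl := bin_closure M φ hφ
  rw [cl _ hWE _ hbE] at hb
  rw [cl _ hWE _ hcE] at hc
  rw [cl _ (insert_subset haE hWE) _ hbE, image_insert_eq, Submodule.mem_span_insert] at hba
  rw [cl _ (by simp [insert_subset_iff, *]) _ hcE] at habc hac hbc
  simp only [image_insert_eq, image_singleton] at habc hac hbc
  rw [Submodule.mem_span_insert] at habc
  obtain ⟨l, z, hz, hcz⟩ := habc
  obtain ⟨m, w, hw, hbw⟩ := hba
  have hz' := hz
  rw [Submodule.mem_span_insert] at hz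
  obtain ⟨n, y, hy, hzy⟩ := hz
  rcases z2 l with rfl | rfl
  · apply hbc
    rw [hcz]; simpa using hz'
  rcases z2 n with rfl | rfl
  · apply hac
    rw [hcz, hzy]
    refine Submodule.mem_span_insert.2 ⟨1, y, hy, by simp⟩
  rcases z2 m with rfl | rfl
  · apply hb
    rw [hbw]; simpa using hw
  apply hc
  have hyW : y ∈ Submodule.span (ZMod 2) (φ '' W) := by
    refine Submodule.span_mono ?_ hy
    simpa using mem_image_of_mem φ heW
  have : φ c = w + y := by
    rw [hcz, hzy, hbw]
    have h2 : φ a + φ a = 0 := by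
      ext i; exact CharTwo.add_self_eq_zero _
    simp only [one_smul]
    calc φ a + (φ a + w + y) = (φ a + φ a) + (w + y) := by abel
      _ = w + y := by rw [h2, zero_add]
  rw [this]
  exact add_mem hw hyW

lemma half (M : Matroid α) (hB : Binary M) (r : Set α → ℕ) (hr : ∀ X, M.eRk X = r X)
    (a b c e : α) (W : Set α)
    (haE : a ∈ M.E) (hbE : b ∈ M.E) (hcE : c ∈ M.E) (hWE : W ⊆ M.E) (heW : e ∈ W)
    (hE : r M.E = 4) (hW : r W = 3) (hU : r {a, b, c, e} = 3)
    (h1 : r (insert a W) = 4) (h2 : r (insert b W) = 4) (h3 : r (insert c W) = 4)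
    (h4 : 3 ≤ r {a, b, e}) (h5 : 3 ≤ r {a, c, e}) (h6 : 3 ≤ r {b, c, e}) : False := by
  have mono : ∀ {X Y : Set α}, X ⊆ Y → r X ≤ r Y := by
    intro X Y h
    have := M.eRk_mono h
    rw [hr, hr] at this; exact_mod_cast this
  have clm : ∀ x Z, x ∈ M.closure Z → r (insert x Z) = r Z := by
    intro x Z h
    have : M.eRk (insert x Z) = M.eRk Z := by
      rw [← M.eRk_closure_eq, closure_insert_eq_of_mem_closure h, M.eRk_closure_eq]
    rw [hr, hr] at this; exact_mod_cast this
  have clm' : ∀ x Z, x ∈ M.E → x ∉ M.closure Z → r (insert x Z) = r Z + 1 := by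
    intro x Z hx h
    have := M.eRk_insert_eq_add_one ⟨hx, h⟩
    rw [hr, hr] at this; exact_mod_cast this
  have pair : ∀ x y : α, r {x, y} ≤ 2 := by
    intro x y
    have h := (M.eRk_le_encard {x, y}).trans (encard_insert_le _ _)
    rw [hr, encard_singleton] at h; exact_mod_cast h
  have heE := hWE heW
  refine binary_core M hB a b c e W haE hbE hcE hWE heW ?_ ?_ ?_ ?_ ?_ ?_
  · intro h; have := clm _ _ h; omega
  · intro h; have := clm _ _ h; omega
  · by_contra h
    have := clm' _ _ hbE h
    have := mono (insert_subset hbE (insert_subset haE hWE))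
    omega
  · by_contra h
    have h7 := clm' _ _ hcE h
    have : insert c {a, b, e} = ({a, b, c, e} : Set α) := by ext; simp; tauto
    rw [this] at h7
    omega
  · intro h
    have h7 := clm _ _ h
    rw [insert_comm] at h7
    have := pair a e
    omega
  · intro h
    have h7 := clm _ _ h
    rw [insert_comm] at h7
    have := pair b e
    omega

lemma half' (M : Matroid α) (hB : Binary M) (r : Set α → ℕ) (hr : ∀ X, M.eRk X = r X)
    (e : α) (X Y : Set α) (he : e ∈ M.E) (heX : e ∉ X)
    (hXY : Disjoint X Y) (hU : insert e (X ∪ Y) = M.E)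
    (hX3 : X.encard = 3) (hE : r M.E = 4) (hX : r (insert e X) = 3) (hY : r (insert e Y) = 3)
    (hp : ∀ Z p q, p ≠ q → Disjoint Z {p, q} → Z ∪ {p, q} = M.E → r Z = 4) :
    ∃ p ∈ X, r (insert e (X \ {p})) ≤ 2 := by
  by_contra! hcon
  obtain ⟨a, b, c, hab, hac, hbc, rfl⟩ := encard_eq_three.1 hX3
  simp only [mem_insert_iff, mem_singleton_iff, not_or] at heX
  simp only [disjoint_insert_left, disjoint_singleton_left] at hXY
  have hE' : ∀ x, x ∈ M.E ↔ (x = e ∨ (x = a ∨ x = b ∨ x = c) ∨ x ∈ Y) := by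
    intro x; rw [← hU]; simp
  refine half M hB r hr a b c e (insert e Y) ?_ ?_ ?_ ?_ ?_ hE hY ?_ ?_ ?_ ?_ ?_ ?_ ?_
  · rw [hE']; tauto
  · rw [hE']; tauto
  · rw [hE']; tauto
  · intro x hx; rw [hE']; rcases hx with h | h <;> tauto
  · simp
  · rw [← hX]; congr 1; ext; simp; tauto
  · apply hp _ b c hbc
    · simp only [disjoint_insert_right, disjoint_singleton_right, mem_insert_iff]
      grind
    · rw [← hU]; ext; simp; tauto
  · apply hp _ a c hac
    · simp only [disjoint_insert_right, disjoint_singleton_right, mem_insert_iff]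
      grind
    · rw [← hU]; ext; simp; tauto
  · apply hp _ a b hab
    · simp only [disjoint_insert_right, disjoint_singleton_right, mem_insert_iff]
      grind
    · rw [← hU]; ext; simp; tauto
  · have := hcon c (by simp)
    have h : insert e (({a, b, c} : Set α) \ {c}) = {a, b, e} := by ext; simp; grind
    rw [h] at this; exact this
  · have := hcon b (by simp)
    have h : insert e (({a, b, c} : Set α) \ {b}) = {a, c, e} := by ext; simp; grind
    rw [h] at this; exact this
  · have := hcon a (by simp)
    have h : insert e (({a, b, c} : Set α) \ {a}) = {b, c, e} := by ext; simp; grind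
    rw [h] at this; exact this

lemma final (M : Matroid α) (hB : Binary M) (r : Set α → ℕ) (hr : ∀ X, M.eRk X = r X)
    (e : α) (X Y : Set α) (he : e ∈ M.E) (heX : e ∉ X) (heY : e ∉ Y)
    (hXY : Disjoint X Y) (hU : insert e (X ∪ Y) = M.E) (he1 : 1 ≤ r {e})
    (hX3 : X.encard = 3) (hY3 : Y.encard = 3)
    (hE : r M.E = 4) (hX : r (insert e X) = 3) (hY : r (insert e Y) = 3)
    (hp : ∀ Z p q, p ≠ q → Disjoint Z {p, q} → Z ∪ {p, q} = M.E → r Z = 4) : False := by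
  obtain ⟨p, hpX, hp2⟩ := half' M hB r hr e X Y he heX hXY hU hX3 hE hX hY hp
  obtain ⟨q, hqY, hq2⟩ := half' M hB r hr e Y X he heY hXY.symm (by rwa [union_comm]) hY3 hE hY hX hp
  have hpq : p ≠ q := by rintro rfl; exact (disjoint_left.1 hXY) hpX hqY
  have hpe : p ≠ e := by rintro rfl; exact heX hpX
  have hqe : q ≠ e := by rintro rfl; exact heY hqY
  have hpY := disjoint_left.1 hXY hpX
  have hqX := disjoint_right.1 hXY hqY
  have h := hp (insert e (X \ {p}) ∪ insert e (Y \ {q})) p q hpq ?_ ?_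
  · have h2 := M.eRk_inter_add_eRk_union_le (insert e (X \ {p})) (insert e (Y \ {q}))
    simp only [hr] at h2
    norm_cast at h2
    have h3 : r {e} ≤ r (insert e (X \ {p}) ∩ insert e (Y \ {q})) := by
      have := M.eRk_mono (show {e} ⊆ (insert e (X \ {p}) ∩ insert e (Y \ {q})) by simp)
      simp only [hr] at this
      exact_mod_cast this
    omega
  · simp only [disjoint_insert_right, disjoint_singleton_right]
    simp; tauto
  · rw [← hU]; ext x; simp; grind

lemma core (M : Matroid α) (hI4 : InternallyFourConnected M) (hB : Binary M)
    (r : Set α → ℕ) (hr : ∀ X, M.eRk X = r X)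
    (e : α) (X Y : Set α) (he : e ∈ M.E) (heX : e ∉ X) (heY : e ∉ Y)
    (hXY : Disjoint X Y) (hU : insert e (X ∪ Y) = M.E) (he1 : 1 ≤ r {e})
    (k : ℕ) (hk : k = 1 ∨ k = 2) (hkX : (k : ℕ∞) ≤ X.encard) (hkY : (k : ℕ∞) ≤ Y.encard)
    (hX : k + 1 ≤ r (insert e X)) (hY : k + 1 ≤ r (insert e Y))
    (hs : r (insert e X) + r (insert e Y) ≤ r M.E + k) : False := by
  have mono : ∀ {X Y : Set α}, X ⊆ Y → r X ≤ r Y := by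
    intro X Y h
    have := M.eRk_mono h
    rw [hr, hr] at this; exact_mod_cast this
  have rcard : ∀ (X : Set α) (n : ℕ), X.encard ≤ n → r X ≤ n := by
    intro X n h
    have := (M.eRk_le_encard X).trans h
    rw [hr] at this; exact_mod_cast this
  have sep : ∀ (k : ℕ) (X Y : Set α), Disjoint X Y → X ∪ Y = M.E → (k : ℕ∞) ≤ X.encard →
      (k : ℕ∞) ≤ Y.encard → r X + r Y ≤ r M.E + (k - 1) → IsKSeparation M k X Y := by
    intro k X Y h1 h2 h3 h4 h5
    refine ⟨h1, h2, ?_, h3, h4⟩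
    simp only [eRk_eq, eRank_eq, hr]
    exact_mod_cast h5
  have dX : Disjoint X (insert e Y) := by simp [heX, hXY]
  have dY : Disjoint Y (insert e X) := by simp [heY, hXY.symm]
  have uX : X ∪ insert e Y = M.E := by rw [← hU]; ext; simp
  have uY : Y ∪ insert e X = M.E := by rw [← hU]; ext; simp; tauto
  have cX : (insert e X).encard = X.encard + 1 := encard_insert_of_notMem heX
  have cY : (insert e Y).encard = Y.encard + 1 := encard_insert_of_notMem heY
  have mX : r X ≤ r (insert e X) := mono (subset_insert _ _)
  have mY : r Y ≤ r (insert e Y) := mono (subset_insert _ _)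
  have nX : ¬ X.encard ≤ k := by
    intro h
    refine hI4.1 k (by omega) (by omega) _ _ (sep k _ _ dX uX hkX (hkY.trans ?_) ?_)
    · rw [cY]; exact le_self_add
    · have := rcard _ _ h
      omega
  have nY : ¬ Y.encard ≤ k := by
    intro h
    refine hI4.1 k (by omega) (by omega) _ _ (sep k _ _ dY uY hkY (hkX.trans ?_) ?_)
    · rw [cX]; exact le_self_add
    · have := rcard _ _ h
      omega
  have kX : ((k + 1 : ℕ) : ℕ∞) ≤ X.encard := by
    push_cast; exact Order.add_one_le_of_lt (not_le.1 nX)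
  have kY : ((k + 1 : ℕ) : ℕ∞) ≤ Y.encard := by
    push_cast; exact Order.add_one_le_of_lt (not_le.1 nY)
  have sX : IsKSeparation M (k+1) X (insert e Y) :=
    sep _ _ _ dX uX kX (kY.trans (by rw [cY]; exact le_self_add)) (by omega)
  have sY : IsKSeparation M (k+1) Y (insert e X) :=
    sep _ _ _ dY uY kY (kX.trans (by rw [cX]; exact le_self_add)) (by omega)
  rcases hk with rfl | rfl
  · exact hI4.1 2 (by omega) (by omega) _ _ sX
  have hcard : ∀ Z Z' : Set α, (3 : ℕ∞) ≤ Z'.encard → (insert e Z').encard = Z'.encard + 1 →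
      IsKSeparation M 3 Z (insert e Z') → Z.encard = 3 := by
    intro Z Z' h1 h2 h3
    have h4 : (insert e Z').encard ≠ 3 := by
      rw [h2]
      intro h
      have : (3 : ℕ∞) + 1 ≤ 3 := by
        calc (3 : ℕ∞) + 1 ≤ Z'.encard + 1 := by gcongr
          _ = 3 := h
      exact absurd this (by decide)
    rcases hI4.2 _ _ h3 with h | h | h | h
    · exact h.2
    · exact h.2
    · exact absurd h.2 h4
    · exact absurd h.2 h4
  have X3 : X.encard = 3 := hcard X Y kY cY sX
  have Y3 : Y.encard = 3 := hcard Y X kX cX sY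
  have no2 : ∀ Z Z' : Set α, Disjoint Z Z' → Z ∪ Z' = M.E → (2 : ℕ∞) ≤ Z.encard →
      (2 : ℕ∞) ≤ Z'.encard → r M.E + 2 ≤ r Z + r Z' := by
    intro Z Z' h1 h2 h3 h4
    by_contra hh
    exact hI4.1 2 (by omega) (by omega) _ _ (sep 2 _ _ h1 h2 h3 h4 (by omega))
  have n1 := no2 _ _ dX uX hkX (hkY.trans (by rw [cY]; exact le_self_add))
  have n2 := no2 _ _ dY uY hkY (hkX.trans (by rw [cX]; exact le_self_add))
  have rX := rcard X 3 X3.le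
  have rY := rcard Y 3 Y3.le
  have hE7 : M.E.encard = 7 := by
    rw [← uX, encard_union_eq dX, cY, X3, Y3]; rfl
  refine final M hB r hr e X Y he heX heY hXY hU he1 X3 Y3 (by omega) (by omega) (by omega) ?_
  intro Z p q hpq hd hu
  have h2 : ({p, q} : Set α).encard = 2 := encard_pair hpq
  have hZ : (2 : ℕ∞) ≤ Z.encard := by
    rw [← hu, encard_union_eq hd, h2] at hE7
    by_contra hh
    have : Z.encard + 2 ≤ 2 + 2 := by gcongr; exact (not_le.1 hh).le
    rw [hE7] at this
    exact absurd this (by decide)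
  have h3 := no2 Z _ hd hu hZ h2.ge
  have h4 := rcard _ 2 h2.le
  have h5 : r Z ≤ r M.E := mono (by rw [← hu]; exact subset_union_left)
  omega

theorem stmt1 (M : Matroid α) (hI4 : InternallyFourConnected M) (hB : Binary M)
    (e : α) (he : e ∈ M.E) :
    ∀ N, IsSimplificationOf N (contract M {e}) → NConnected N 3 := by
  rintro N ⟨S, hSE, rfl, hSn, hSu⟩ k hk1 hk3 X Y ⟨hXY, hU, hs, hkX, hkY⟩
  have hK0 : contract M {e} = M ／ {e} := rfl
  generalize contract M {e} = K at *
  have hK : K = M ／ {e} := hK0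
  simp only [restrict_ground_eq] at hU
  have hXS : X ⊆ S := hU ▸ subset_union_left
  have hYS : Y ⊆ S := hU ▸ subset_union_right
  simp only [eRk_eq, eRank_eq, restrict_ground_eq] at hs
  rw [restrict_eRk_eq _ hXS, restrict_eRk_eq _ hYS, restrict_eRk_eq _ le_rfl] at hs
  have hKE : K.E = M.E \ {e} := by rw [hK, contract_ground]
  have one : ∀ Z : Set α, (k : ℕ∞) ≤ Z.encard → Z.Nonempty := by
    intro Z hZ
    rw [← encard_ne_zero]
    rintro h
    rw [h] at hZ
    have : k ≤ 0 := by exact_mod_cast hZ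
    omega
  have hXn := one X hkX
  -- finiteness of the rank, and `e` is not a loop
  have hnot : ¬ (M.eRk {e} + M.eRk (M.E \ {e}) ≤ M.eRk M.E) := by
    intro h
    refine hI4.1 1 le_rfl (by omega) {e} (M.E \ {e}) ⟨disjoint_sdiff_right, ?_, ?_, ?_, ?_⟩
    · rw [union_sdiff_self]; simpa using he
    · simpa [eRk_eq, eRank_eq] using h
    · simp
    · obtain ⟨x, hx⟩ := hXn
      have : (M.E \ {e}).Nonempty := ⟨x, hKE ▸ hSE (hXS hx)⟩
      simpa [one_le_encard_iff_nonempty] using this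
  have hfin : M.eRk M.E ≠ ⊤ := by
    intro h; exact hnot (h ▸ le_top)
  have he0 : M.eRk {e} ≠ 0 := by
    intro h; apply hnot; rw [h, zero_add]; exact M.eRk_mono sdiff_subset
  have heI : M.Indep {e} := by
    have h1 : M.eRk {e} = 1 := le_antisymm (M.eRk_singleton_le e) (Order.one_le_iff_ne_zero.2 he0)
    exact (eRk_singleton_eq_one_iff.1 h1).indep
  obtain ⟨r, hr⟩ : ∃ r : Set α → ℕ, ∀ X, M.eRk X = r X := by
    refine ⟨fun X => (M.eRk X).toNat, fun X => (ENat.natCast_toNat ?_).symm⟩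
    have := M.eRk_le_eRank X
    rw [← eRk_ground] at this
    exact ne_top_of_le_ne_top hfin this
  have hKr : ∀ Z, Z ⊆ K.E → K.eRk Z + 1 = r (insert e Z) := by
    intro Z hZ
    rw [hKE] at hZ
    rw [← hr, hK]
    exact contract_rk M e heI Z (hZ.trans sdiff_subset) (fun h => (hZ h).2 rfl)
  -- distinct elements of `S` are not parallel
  have huniq : ∀ x ∈ S, ∀ y ∈ S, K.closure {x} = K.closure {y} → x = y := by
    intro x hx y hy hxy
    exact (hSu y (hSn y hy)).unique ⟨hx, hxy⟩ ⟨hy, rfl⟩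
  have hrank : ∀ Z, Z ⊆ S → (k : ℕ∞) ≤ Z.encard → (k : ℕ∞) ≤ K.eRk Z := by
    intro Z hZS hZ
    obtain ⟨x, hx⟩ := one Z hZ
    have h1 : K.eRk {x} = 1 := by
      rw [(hSn x (hZS hx)).eRk_eq_encard]; simp
    obtain rfl | rfl : k = 1 ∨ k = 2 := by omega
    · rw [Nat.cast_one, ← h1]; exact K.eRk_mono (by simpa using hx)
    · have : 1 < Z.encard := lt_of_lt_of_le (by decide) hZ
      obtain ⟨y, hy, hyx⟩ := exists_ne_of_one_lt_encard this x
      have hyn : y ∉ K.closure {x} := by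
        intro hmem
        apply hyx
        apply huniq y (hZS hy) x (hZS hx)
        have hnl : K.IsNonloop y := indep_singleton.1 (hSn y (hZS hy))
        exact hnl.closure_eq_of_mem_closure hmem
      have h2 := K.eRk_insert_eq_add_one ⟨hSE (hZS hy), hyn⟩
      rw [h1] at h2
      have h3 : K.eRk {y, x} ≤ K.eRk Z := K.eRk_mono (by
        intro z hz; rcases hz with rfl | rfl <;> assumption)
      rw [h2] at h3
      exact h3
  -- extend the partition
  obtain ⟨X', hX'⟩ : ∃ X' : Set α, X' = {f | f ∈ K.E ∧ ∃ x ∈ X, K.closure {x} = K.closure {f}} :=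
    ⟨_, rfl⟩
  obtain ⟨Y', hY'⟩ : ∃ Y' : Set α, Y' = K.E \ X' := ⟨_, rfl⟩
  have hX'E : X' ⊆ K.E := by rw [hX']; exact fun f hf => hf.1
  have hY'E : Y' ⊆ K.E := by rw [hY']; exact sdiff_subset
  have hXX' : X ⊆ X' := by
    rw [hX']; exact fun x hx => ⟨hSE (hXS hx), x, hx, rfl⟩
  have hYY' : Y ⊆ Y' := by
    intro y hy
    rw [hY']
    refine ⟨hSE (hYS hy), ?_⟩
    rw [hX']
    rintro ⟨_, x, hx, hxy⟩
    have := huniq x (hXS hx) y (hYS hy) hxy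
    subst this
    exact disjoint_left.1 hXY hx hy
  have hcl : ∀ f ∈ K.E, ∀ Z, ∀ x ∈ Z, K.closure {x} = K.closure {f} → f ∈ K.closure Z := by
    intro f hf Z x hx hxf
    have h1 : f ∈ K.closure {f} := K.mem_closure_self f hf
    rw [← hxf] at h1
    exact K.closure_subset_closure (by simpa using hx) h1
  have hX'c : X' ⊆ K.closure X := by
    rw [hX']
    rintro f ⟨hf, x, hx, hxf⟩
    exact hcl f hf X x hx hxf
  have hY'c : Y' ⊆ K.closure Y := by
    intro f hf
    have hfE := hY'E hf
    rw [hY', hX'] at hf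
    by_cases hn : Nonloop K f
    · obtain ⟨x, ⟨hxS, hxf⟩, _⟩ := hSu f hn
      rw [← hU] at hxS
      rcases hxS with hx | hx
      · exact absurd ⟨hfE, x, hx, hxf⟩ hf.2
      · exact hcl f hfE Y x hx hxf
    · have hl : K.IsLoop f := by
        by_contra h
        exact hn (indep_singleton.2 ((not_isLoop_iff hfE).1 h))
      exact hl.mem_closure Y
  have rX : K.eRk X' = K.eRk X := le_antisymm
    ((K.eRk_mono hX'c).trans (K.eRk_closure_eq X).le) (K.eRk_mono hXX')
  have rY : K.eRk Y' = K.eRk Y := le_antisymm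
    ((K.eRk_mono hY'c).trans (K.eRk_closure_eq Y).le) (K.eRk_mono hYY')
  have hX1 := hKr X' hX'E
  have hY1 := hKr Y' hY'E
  have hE1 := hKr K.E le_rfl
  have hEE : insert e K.E = M.E := by
    rw [hKE]; simp [he]
  rw [hEE] at hE1
  have hSE1 : K.eRk S ≤ K.eRk K.E := K.eRk_mono hSE
  have hkx := hrank X hXS hkX
  have hky := hrank Y hYS hkY
  have heX : e ∉ X' := fun h => by have := hX'E h; rw [hKE] at this; exact this.2 rfl
  have heY : e ∉ Y' := fun h => by have := hY'E h; rw [hKE] at this; exact this.2 rfl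
  rw [rX] at hX1
  rw [rY] at hY1
  have hs' := hs.trans (add_le_add_left hSE1 _)
  generalize K.eRk X = p at *
  generalize K.eRk Y = q at *
  generalize K.eRk K.E = t at *
  have nt : ∀ (p : ℕ∞) (n : ℕ), p + 1 = n → ∃ m : ℕ, p = m := by
    intro p n h
    refine ⟨p.toNat, (ENat.natCast_toNat ?_).symm⟩
    rintro rfl
    simp at h
  obtain ⟨p, rfl⟩ := nt _ _ hX1
  obtain ⟨q, rfl⟩ := nt _ _ hY1
  obtain ⟨t, rfl⟩ := nt _ _ hE1
  have a1 : p + 1 = r (insert e X') := by exact_mod_cast hX1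
  have a2 : q + 1 = r (insert e Y') := by exact_mod_cast hY1
  have a3 : t + 1 = r M.E := by exact_mod_cast hE1
  have a4 : k ≤ p := by exact_mod_cast hkx
  have a5 : k ≤ q := by exact_mod_cast hky
  have a6 : p + q ≤ t + (k - 1) := by exact_mod_cast hs'
  refine core M hI4 hB r hr e X' Y' he heX heY ?_ ?_ ?_ k (by omega)
    (hkX.trans (encard_le_encard hXX')) (hkY.trans (encard_le_encard hYY'))
    (by omega) (by omega) (by omega)
  · rw [hY']; exact disjoint_sdiff_right
  · rw [hY', union_sdiff_self, union_eq_self_of_subset_left hX'E, hEE]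
  · rw [hr] at he0
    have : r {e} ≠ 0 := by exact_mod_cast he0
    omega

end Paper
end

section
/- Let M be an internally 4-connected binary matroid in which every element is in exactly three triangles and whose ground set has at least 14 elements. If C* is a 4-element cocircuit of M, then, for every element e of C*, the matroid si(M/e) is internally 4-connected and has no triads. -/
open Set Matroid

namespace Paper

variable {α : Type*}

lemma isKSep_iff (M : Matroid α) (k : ℕ) (X Y : Set α) : IsKSeparation M k X Y ↔
    Disjoint X Y ∧ X ∪ Y = M.E ∧ M.eRk X + M.eRk Y ≤ M.eRk M.E + ((k - 1 : ℕ) : ℕ∞) ∧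
    (k : ℕ∞) ≤ X.encard ∧ (k : ℕ∞) ≤ Y.encard := by
  unfold IsKSeparation eRk
  simp only [eRank_eq]

/-- In a 3-connected matroid with enough elements, pairs are independent. -/
lemma pair_indep {M : Matroid α} (h : NConnected M 3) (hE : (10 : ℕ∞) ≤ M.E.encard) {a b : α}
    (ha : a ∈ M.E) (hb : b ∈ M.E) (hab : a ≠ b) : M.Indep {a, b} := by
  by_contra hn
  have hsub : ({a, b} : Set α) ⊆ M.E := by
    intro x hx; rcases hx with rfl | rfl <;> assumption
  have h2 : ({a, b} : Set α).encard = 2 := encard_pair hab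
  have hr : M.eRk {a, b} < 2 := by
    rw [← h2]
    exact eRk_lt_encard_of_dep_of_finite (by simp) ⟨hn, hsub⟩
  have hr1 : M.eRk {a, b} ≤ 1 := by
    exact Order.le_of_lt_add_one (by simpa [one_add_one_eq_two] using hr)
  have hc : (M.E \ {a, b}).encard + 2 = M.E.encard := by
    rw [← h2]; exact encard_sdiff_add_encard_of_subset hsub
  refine h 2 (by norm_num) (by norm_num) {a, b} (M.E \ {a, b}) ((isKSep_iff _ _ _ _).2
    ⟨disjoint_sdiff_right, union_sdiff_cancel hsub, ?_, ?_, ?_⟩)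
  · have := M.eRk_mono (sdiff_subset : M.E \ {a, b} ⊆ M.E)
    calc _ ≤ 1 + M.eRk M.E := add_le_add hr1 this
      _ = _ := by rw [add_comm]; norm_num
  · rw [h2]; norm_num
  · by_contra hlt
    push Not at hlt
    have : (M.E \ {a, b}).encard + 2 ≤ 2 + 2 := by gcongr; exact hlt.le
    rw [hc] at this
    exact absurd (hE.trans this) (by norm_num)

section Rep

variable {M : Matroid α} {φ : α → (α →₀ ZMod 2)}

lemma mem_cl_indep (hφ : ∀ I, I ⊆ M.E →
    (M.Indep I ↔ LinearIndependent (ZMod 2) (fun x : I => φ x.1))) {I : Set α}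
    (hI : M.Indep I) {y : α} (hy : y ∈ M.E) :
    y ∈ M.closure I ↔ φ y ∈ Submodule.span (ZMod 2) (φ '' I) := by
  have hIE := hI.subset_ground
  rw [hI.mem_closure_iff', hφ _ (insert_subset hy hIE)]
  have h1 : LinearIndepOn (ZMod 2) φ I := (hφ I hIE).1 hI
  have h2 := linearIndepOn_insert_iff (K := ZMod 2) (s := I) (a := y) (f := φ)
  unfold LinearIndepOn at h2
  rw [h2]
  constructor
  · rintro ⟨-, h⟩
    by_contra hn
    exact hn (Submodule.subset_span ⟨y, h ⟨h1, fun h => absurd h hn⟩, rfl⟩)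
  · intro h
    exact ⟨hy, fun h' => h'.2 h⟩

lemma mem_cl (hφ : ∀ I, I ⊆ M.E →
    (M.Indep I ↔ LinearIndependent (ZMod 2) (fun x : I => φ x.1))) {X : Set α}
    (hX : X ⊆ M.E) {y : α} (hy : y ∈ M.E) :
    y ∈ M.closure X ↔ φ y ∈ Submodule.span (ZMod 2) (φ '' X) := by
  obtain ⟨I, hI⟩ := M.exists_isBasis X
  rw [← hI.closure_eq_closure, mem_cl_indep hφ hI.indep hy]
  have : Submodule.span (ZMod 2) (φ '' I) = Submodule.span (ZMod 2) (φ '' X) := by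
    apply le_antisymm (Submodule.span_mono (image_mono hI.subset))
    rw [Submodule.span_le]
    rintro _ ⟨x, hx, rfl⟩
    exact (mem_cl_indep hφ hI.indep (hX hx)).1 (hI.subset_closure hx)
  rw [this]

lemma zmod2_add_self (v : α →₀ ZMod 2) : v + v = 0 := by
  ext i; simp [CharTwo.add_self_eq_zero]

lemma triangle_sum (hφ : ∀ I, I ⊆ M.E →
    (M.Indep I ↔ LinearIndependent (ZMod 2) (fun x : I => φ x.1))) {a b c : α}
    (hab : a ≠ b) (hac : a ≠ c) (hbc : b ≠ c) (hT : Circuit M {a, b, c}) :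
    φ a = φ b + φ c := by
  obtain ⟨hE, hd, hi⟩ := hT
  have ha : a ∈ M.E := hE (by simp)
  have hb : b ∈ M.E := hE (by simp)
  have hc : c ∈ M.E := hE (by simp)
  have ibc : M.Indep {b, c} := hi _ (by
    rw [ssubset_iff_of_subset (by simp)]; exact ⟨a, by simp, by simp [hab, hac]⟩)
  have iab : M.Indep {a, b} := hi _ (by
    rw [ssubset_iff_of_subset (by intro x; simp; tauto)]
    exact ⟨c, by simp, by simp [hac.symm, hbc.symm]⟩)
  have iac : M.Indep {a, c} := hi _ (by
    rw [ssubset_iff_of_subset (by intro x; simp; tauto)]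
    exact ⟨b, by simp, by simp [hab.symm, hbc]⟩)
  have h1 : a ∈ M.closure {b, c} := by
    rw [ibc.mem_closure_iff']
    exact ⟨ha, fun h => absurd h hd⟩
  have h2 : a ∉ M.closure {c} := by
    rw [(iac.subset (by simp : ({c} : Set α) ⊆ {a, c})).mem_closure_iff']
    rintro ⟨-, h⟩
    exact hac (h iac)
  have h3 : a ∉ M.closure {b} := by
    rw [(iab.subset (by simp : ({b} : Set α) ⊆ {a, b})).mem_closure_iff']
    rintro ⟨-, h⟩
    exact hab (h iab)
  rw [mem_cl hφ (by intro x; simp; rintro (rfl | rfl) <;> assumption) ha, image_pair,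
    Submodule.mem_span_pair] at h1
  rw [mem_cl hφ (by simpa using hc) ha, image_singleton, Submodule.mem_span_singleton] at h2
  rw [mem_cl hφ (by simpa using hb) ha, image_singleton, Submodule.mem_span_singleton] at h3
  obtain ⟨s, t, hst⟩ := h1
  have hz : ∀ u : ZMod 2, u = 0 ∨ u = 1 := by decide
  rcases hz s with rfl | rfl
  · exact absurd ⟨t, by simpa using hst⟩ h2
  rcases hz t with rfl | rfl
  · exact absurd ⟨1, by simpa using hst⟩ h3
  simpa using hst.symm

lemma phi_inj (hφ : ∀ I, I ⊆ M.E →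
    (M.Indep I ↔ LinearIndependent (ZMod 2) (fun x : I => φ x.1)))
    (hM : NConnected M 3) (hE : (10 : ℕ∞) ≤ M.E.encard) {a b : α}
    (ha : a ∈ M.E) (hb : b ∈ M.E) (hab : φ a = φ b) : a = b := by
  by_contra hne
  have hi := pair_indep hM hE ha hb hne
  have h2 : a ∉ M.closure {b} := by
    rw [(hi.subset (by simp : ({b} : Set α) ⊆ {a, b})).mem_closure_iff']
    rintro ⟨-, h⟩
    exact hne (h hi)
  rw [mem_cl hφ (by simpa using hb) ha, hab] at h2
  exact h2 (Submodule.subset_span ⟨b, rfl, rfl⟩)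

/-- Facts on cocircuits. -/
lemma cocircuit_facts {C : Set α} (hC : Cocircuit M C) :
    C ⊆ M.E ∧ (∀ a ∈ C, a ∉ M.closure (M.E \ C)) ∧
      ∀ a ∈ C, M.closure (insert a (M.E \ C)) = M.E := by
  obtain ⟨hE, hd, hi⟩ := hC
  have hE : C ⊆ M.E := hE
  have h2 : ∀ a ∈ C, M.closure (insert a (M.E \ C)) = M.E := by
    intro a ha
    have : M.Coindep (C \ {a}) := hi _ (sdiff_singleton_ssubset.2 ha)
    have h := this.closure_compl
    rwa [sdiff_sdiff_right, inter_eq_self_of_subset_right (by simpa using hE ha),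
      union_singleton] at h
  refine ⟨hE, fun a ha h => hd ?_, h2⟩
  change M.Coindep C
  rw [coindep_iff_closure_compl_eq_ground hE]
  exact (closure_insert_eq_of_mem_closure h).symm.trans (h2 a ha)

lemma cocircuit_span (hφ : ∀ I, I ⊆ M.E →
    (M.Indep I ↔ LinearIndependent (ZMod 2) (fun x : I => φ x.1))) {C : Set α}
    (hC : Cocircuit M C) :
    (∀ a ∈ C, φ a ∉ Submodule.span (ZMod 2) (φ '' (M.E \ C))) ∧
    (∀ a ∈ C, ∀ b ∈ C, φ a + φ b ∈ Submodule.span (ZMod 2) (φ '' (M.E \ C))) ∧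
    (∀ a ∈ M.E, a ∉ C → φ a ∈ Submodule.span (ZMod 2) (φ '' (M.E \ C))) := by
  obtain ⟨hE, h1, h2⟩ := cocircuit_facts hC
  have h1' : ∀ a ∈ C, φ a ∉ Submodule.span (ZMod 2) (φ '' (M.E \ C)) := by
    intro a ha h
    exact h1 a ha ((mem_cl hφ sdiff_subset (hE ha)).2 h)
  refine ⟨h1', ?_, fun a ha hn => Submodule.subset_span ⟨a, ⟨ha, hn⟩, rfl⟩⟩
  intro a ha b hb
  have hm : b ∈ M.closure (insert a (M.E \ C)) := by rw [h2 a ha]; exact hE hb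
  rw [mem_cl hφ (insert_subset (hE ha) sdiff_subset) (hE hb), image_insert_eq,
    Submodule.mem_span_insert] at hm
  obtain ⟨t, z, hz, hb'⟩ := hm
  have hzz : ∀ u : ZMod 2, u = 0 ∨ u = 1 := by decide
  rcases hzz t with rfl | rfl
  · exact absurd (by simpa [hb'] using hz) (h1' b hb)
  · rw [hb', one_smul, ← add_assoc, zmod2_add_self, zero_add]; exact hz

/-- Triangles through `e` inject into `C \ {e}`. -/
lemma triangles_cocircuit (hφ : ∀ I, I ⊆ M.E →
    (M.Indep I ↔ LinearIndependent (ZMod 2) (fun x : I => φ x.1)))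
    (hM : NConnected M 3) (hE : (10 : ℕ∞) ≤ M.E.encard) (h3 : EveryElementInThreeTriangles M)
    {C : Set α} (hC : Cocircuit M C) {e : α} (he : e ∈ C) :
    ∃ B ⊆ C \ {e}, B.encard = 3 ∧ ∀ b ∈ B, ∃ x ∈ M.E \ C, φ x = φ e + φ b := by
  obtain ⟨hCE, -, -⟩ := cocircuit_facts hC
  obtain ⟨c1, c2, c3⟩ := cocircuit_span hφ hC
  set W := Submodule.span (ZMod 2) (φ '' (M.E \ C))
  have key : ∀ T : Set α, IsTriangle M T ∧ e ∈ T →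
      ∃ b x, b ∈ C \ {e} ∧ x ∈ M.E \ C ∧ φ x = φ e + φ b ∧ T = {e, b, x} := by
    rintro T ⟨⟨hT, hT3⟩, heT⟩
    obtain ⟨p, q, hpe, hqe, hpq, rfl⟩ : ∃ p q, e ≠ p ∧ e ≠ q ∧ p ≠ q ∧ T = {e, p, q} := by
      obtain ⟨x, y, z, hxy, hxz, hyz, rfl⟩ := encard_eq_three.1 hT3
      rcases heT with rfl | rfl | rfl
      · exact ⟨y, z, hxy, hxz, hyz, rfl⟩
      · exact ⟨x, z, hxy.symm, hyz, hxz, by ext; simp; tauto⟩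
      · exact ⟨x, y, hxz.symm, hyz.symm, hxy, by ext; simp; tauto⟩
    have hs := triangle_sum hφ hpe hqe hpq hT
    have hpE : p ∈ M.E := hT.1 (by simp)
    have hqE : q ∈ M.E := hT.1 (by simp)
    by_cases hp : p ∈ C
    · by_cases hq : q ∈ C
      · exact absurd (hs ▸ c2 p hp q hq) (c1 e he)
      · refine ⟨p, q, ⟨hp, hpe.symm⟩, ⟨hqE, hq⟩, ?_, rfl⟩
        rw [hs, add_right_comm, zmod2_add_self, zero_add]
    · by_cases hq : q ∈ C
      · refine ⟨q, p, ⟨hq, hqe.symm⟩, ⟨hpE, hp⟩, ?_, by ext; simp; tauto⟩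
        rw [hs, add_assoc, zmod2_add_self, add_zero]
      · exact absurd (hs ▸ W.add_mem (c3 p hpE hp) (c3 q hqE hq)) (c1 e he)
  have : Nonempty α := ⟨e⟩
  choose! f g hf hg hfg hT using key
  refine ⟨f '' {T : Set α | IsTriangle M T ∧ e ∈ T}, ?_, ?_, ?_⟩
  · rintro _ ⟨T, hT', rfl⟩
    exact hf T hT'
  · rw [InjOn.encard_image, h3 e (hCE he)]
    intro T hT1 T' hT2 hff
    have : g T = g T' := by
      apply phi_inj hφ hM hE (hg T hT1).1 (hg T' hT2).1
      rw [hfg T hT1, hfg T' hT2, hff]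
    rw [hT T hT1, hT T' hT2, hff, this]
  · rintro _ ⟨T, hT', rfl⟩
    exact ⟨g T, hg T hT', hfg T hT'⟩

lemma no_triad (hφ : ∀ I, I ⊆ M.E →
    (M.Indep I ↔ LinearIndependent (ZMod 2) (fun x : I => φ x.1)))
    (hM : NConnected M 3) (hE : (10 : ℕ∞) ≤ M.E.encard) (h3 : EveryElementInThreeTriangles M)
    (T : Set α) : ¬ IsTriad M T := by
  rintro ⟨hT, hT3⟩
  obtain ⟨e, he⟩ : T.Nonempty := by
    rw [← encard_ne_zero, hT3]; norm_num
  obtain ⟨B, hB, hB3, -⟩ := triangles_cocircuit hφ hM hE h3 hT he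
  have h1 := encard_sdiff_singleton_add_one he
  have h2 := encard_le_encard hB
  rw [hB3] at h2
  have : (3 : ℕ∞) + 1 ≤ 3 := by
    calc (3 : ℕ∞) + 1 ≤ (T \ {e}).encard + 1 := by gcongr
      _ = 3 := by rw [h1, hT3]
  exact absurd this (by norm_num)

lemma four_cocircuit (hφ : ∀ I, I ⊆ M.E →
    (M.Indep I ↔ LinearIndependent (ZMod 2) (fun x : I => φ x.1)))
    (hM : NConnected M 3) (hE : (10 : ℕ∞) ≤ M.E.encard) (h3 : EveryElementInThreeTriangles M)
    {C : Set α} (hC : Cocircuit M C) (hC4 : C.encard = 4) {e b : α} (he : e ∈ C) (hb : b ∈ C)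
    (hbe : b ≠ e) : ∃ x ∈ M.E \ C, φ x = φ e + φ b := by
  obtain ⟨B, hB, hB3, h⟩ := triangles_cocircuit hφ hM hE h3 hC he
  have hfin : C.Finite := finite_of_encard_eq_coe (k := 4) hC4
  have h1 : (C \ {e}).encard = 3 := by
    have h1 := encard_sdiff_singleton_add_one he
    rw [hC4] at h1
    have : (C \ {e}).encard + 1 = 3 + 1 := by rw [h1]; norm_num
    exact WithTop.add_right_cancel ENat.one_ne_top this
  have : B = C \ {e} := (hfin.subset (hB.trans sdiff_subset)).eq_of_subset_of_encard_le hB (by rw [h1, hB3])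
  exact h b (this ▸ ⟨hb, hbe⟩)

lemma span_dichotomy {C : Set α} (U V : Submodule (ZMod 2) (α →₀ ZMod 2))
    (h : ∀ a ∈ C, ∀ b ∈ C, φ a + φ b ∈ U ∨ φ a + φ b ∈ V) :
    (∀ a ∈ C, ∀ b ∈ C, φ a + φ b ∈ U) ∨ (∀ a ∈ C, ∀ b ∈ C, φ a + φ b ∈ V) := by
  have tr : ∀ (U : Submodule (ZMod 2) (α →₀ ZMod 2)) (a b c : α), φ a + φ b ∈ U →
      φ b + φ c ∈ U → φ a + φ c ∈ U := by
    intro U a b c h1 h2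
    have := U.add_mem h1 h2
    rwa [← add_assoc, add_assoc (φ a), zmod2_add_self, add_zero] at this
  have sy : ∀ (U : Submodule (ZMod 2) (α →₀ ZMod 2)) (a b : α), φ a + φ b ∈ U →
      φ b + φ a ∈ U := fun U a b h => by rwa [add_comm]
  by_contra! hn
  obtain ⟨⟨i, hi, j, hj, hij⟩, ⟨k, hk, l, hl, hkl⟩⟩ := hn
  have Sij := (h i hi j hj).resolve_left hij
  have Rkl := (h k hk l hl).resolve_right hkl
  rcases h i hi k hk with hik | hik
  · have Ril := tr U _ _ _ hik Rkl
    have Sjk := (h j hj k hk).resolve_left fun h' => hij (tr U _ _ _ hik (sy U _ _ h'))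
    have Sjl := (h j hj l hl).resolve_left fun h' => hij (tr U _ _ _ Ril (sy U _ _ h'))
    exact hkl (tr V _ _ _ (sy V _ _ Sjk) Sjl)
  · have Sjk := tr V _ _ _ (sy V _ _ Sij) hik
    have Ril := (h i hi l hl).resolve_right fun h' => hkl (tr V _ _ _ (sy V _ _ hik) h')
    have Rjl := (h j hj l hl).resolve_right fun h' => hkl (tr V _ _ _ (sy V _ _ Sjk) h')
    exact hij (tr U _ _ _ Ril (sy U _ _ Rjl))

/-- One-sided core: when `A` spans all differences. -/
lemma core_one (hφ : ∀ I, I ⊆ M.E →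
    (M.Indep I ↔ LinearIndependent (ZMod 2) (fun x : I => φ x.1)))
    (hI4 : InternallyFourConnected M) (hE : (10 : ℕ∞) ≤ M.E.encard)
    (h3 : EveryElementInThreeTriangles M)
    {C : Set α} (hC : Cocircuit M C) (hC4 : C.encard = 4) {A B : Set α} {k : ℕ} (hk1 : 1 ≤ k)
    (hk : k < 4)
    (hAB : Disjoint A B) (hH : A ∪ B = M.E \ C)
    (hr : M.eRk A + M.eRk B ≤ M.eRk (M.E \ C) + ((k - 1 : ℕ) : ℕ∞))
    (hB : (k : ℕ∞) ≤ B.encard)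
    (hU : ∀ a ∈ C, ∀ b ∈ C, φ a + φ b ∈ Submodule.span (ZMod 2) (φ '' A)) :
    k = 3 ∧ B.encard = 3 ∧ M.eRk B ≤ 2 := by
  obtain ⟨hCE, f1, f2⟩ := cocircuit_facts hC
  obtain ⟨e, he⟩ : C.Nonempty := by
    rw [← encard_ne_zero, hC4]; norm_num
  have hAE : A ⊆ M.E := (subset_union_left.trans hH.subset).trans sdiff_subset
  have hr1 : M.eRk (A ∪ C) ≤ M.eRk A + 1 := by
    refine le_trans ?_ (M.eRk_insert_le_add_one e A)
    rw [← M.eRk_closure_eq (insert e A)]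
    apply M.eRk_mono
    have hie : insert e A ⊆ M.E := insert_subset (hCE he) hAE
    rintro x (hx | hx)
    · exact M.subset_closure _ hie (mem_insert_of_mem _ hx)
    · rw [mem_cl hφ hie (hCE hx)]
      have h1 : φ x + φ e ∈ Submodule.span (ZMod 2) (φ '' insert e A) :=
        Submodule.span_mono (image_mono (subset_insert _ _)) (hU x hx e he)
      have h2 : φ e ∈ Submodule.span (ZMod 2) (φ '' insert e A) :=
        Submodule.subset_span ⟨e, mem_insert _ _, rfl⟩
      have := Submodule.add_mem _ h1 h2
      rwa [add_assoc, zmod2_add_self, add_zero] at this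
  have hr2 : M.eRk (M.E \ C) + 1 = M.eRk M.E := by
    rw [← eRk_insert_eq_add_one ⟨hCE he, f1 e he⟩, ← M.eRk_closure_eq, f2 e he]
  have hAC4 : (4 : ℕ∞) ≤ (A ∪ C).encard := by
    rw [← hC4]; exact encard_le_encard subset_union_right
  have hsep : IsKSeparation M k (A ∪ C) B := by
    rw [isKSep_iff]
    refine ⟨?_, ?_, ?_, ?_, hB⟩
    · rw [disjoint_union_left]
      refine ⟨hAB, ?_⟩
      exact (disjoint_sdiff_right (s := C) (t := M.E)).mono_right (hH ▸ subset_union_right)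
    · rw [union_right_comm, hH, sdiff_union_of_subset hCE]
    · calc _ ≤ (M.eRk A + 1) + M.eRk B := by gcongr
        _ = (M.eRk A + M.eRk B) + 1 := by ring
        _ ≤ (M.eRk (M.E \ C) + ((k - 1 : ℕ) : ℕ∞)) + 1 := by gcongr
        _ = _ := by rw [← hr2]; ring
    · refine le_trans ?_ hAC4
      exact_mod_cast hk.le
  by_cases hk3 : k < 3
  · exact absurd hsep (hI4.1 k hk1 hk3 _ _)
  obtain rfl : k = 3 := by omega
  have hno : (A ∪ C).encard ≠ 3 := fun h => by
    rw [h] at hAC4; exact absurd hAC4 (by norm_num)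
  rcases hI4.2 _ _ hsep with h | h | h | h
  · exact absurd h.2 hno
  · exact absurd h.2 hno
  · refine ⟨rfl, h.2, ?_⟩
    have : M.eRk B < 3 := by
      rw [← h.2]
      exact eRk_lt_encard_of_dep_of_finite (finite_of_encard_eq_coe (k := 3) h.2)
        ⟨h.1.2.1, h.1.1⟩
    exact Order.le_of_lt_add_one (by rw [show (2 : ℕ∞) + 1 = 3 by norm_num]; exact this)
  · exact absurd h (no_triad hφ hI4.1 hE h3 _)

lemma core_s5 (hφ : ∀ I, I ⊆ M.E →
    (M.Indep I ↔ LinearIndependent (ZMod 2) (fun x : I => φ x.1)))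
    (hI4 : InternallyFourConnected M) (hE : (10 : ℕ∞) ≤ M.E.encard)
    (h3 : EveryElementInThreeTriangles M)
    {C : Set α} (hC : Cocircuit M C) (hC4 : C.encard = 4) {A B : Set α} {k : ℕ} (hk1 : 1 ≤ k)
    (hk : k < 4)
    (hAB : Disjoint A B) (hH : A ∪ B = M.E \ C)
    (hr : M.eRk A + M.eRk B ≤ M.eRk (M.E \ C) + ((k - 1 : ℕ) : ℕ∞))
    (hA : (k : ℕ∞) ≤ A.encard) (hB : (k : ℕ∞) ≤ B.encard) :
    k = 3 ∧ ((A.encard = 3 ∧ M.eRk A ≤ 2) ∨ (B.encard = 3 ∧ M.eRk B ≤ 2)) := by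
  rcases span_dichotomy (φ := φ) (C := C) (Submodule.span (ZMod 2) (φ '' A))
    (Submodule.span (ZMod 2) (φ '' B)) (by
      intro a ha b hb
      by_cases hab : b = a
      · subst hab; left; rw [zmod2_add_self]; exact Submodule.zero_mem _
      obtain ⟨x, hx, hx'⟩ := four_cocircuit hφ hI4.1 hE h3 hC hC4 ha hb hab
      rw [← hx']
      rw [← hH] at hx
      rcases hx with hx | hx
      · left; exact Submodule.subset_span ⟨x, hx, rfl⟩
      · right; exact Submodule.subset_span ⟨x, hx, rfl⟩) with hU | hV
  · obtain ⟨h1, h2⟩ := core_one hφ hI4 hE h3 hC hC4 hk1 hk hAB hH hr hB hU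
    exact ⟨h1, Or.inr h2⟩
  · obtain ⟨h1, h2⟩ := core_one hφ hI4 hE h3 hC hC4 hk1 hk hAB.symm (by rwa [union_comm])
      (by rwa [add_comm]) hA hV
    exact ⟨h1, Or.inl h2⟩

end Rep

/-- Final abstract step: a matroid satisfying the core property. -/
lemma finish {N : Matroid α} (hE : (10 : ℕ∞) ≤ N.E.encard)
    (h : ∀ k : ℕ, 1 ≤ k → k < 4 → ∀ X Y, IsKSeparation N k X Y →
      k = 3 ∧ ((X.encard = 3 ∧ N.eRk X ≤ 2) ∨ (Y.encard = 3 ∧ N.eRk Y ≤ 2))) :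
    InternallyFourConnected N ∧ ∀ T, ¬ IsTriad N T := by
  have hN : NConnected N 3 := by
    intro k hk1 hk X Y hs
    have := (h k hk1 (by omega) X Y hs).1
    omega
  have tri : ∀ X ⊆ N.E, X.encard = 3 → N.eRk X ≤ 2 → IsTriangle N X := by
    intro X hX hX3 hr
    refine ⟨⟨hX, ?_, ?_⟩, hX3⟩
    · intro hi
      rw [hi.eRk_eq_encard, hX3] at hr
      exact absurd hr (by norm_num)
    · intro D hD
      obtain ⟨x, hx, hxD⟩ := exists_of_ssubset hD
      have hsub : D ⊆ X \ {x} := subset_sdiff_singleton hD.subset hxD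
      have h1 : (X \ {x}).encard = 2 := by
        have h1 := encard_sdiff_singleton_add_one hx
        have : (X \ {x}).encard + 1 = 2 + 1 := by rw [h1, hX3]; norm_num
        exact WithTop.add_right_cancel ENat.one_ne_top this
      obtain ⟨a, b, hab, heq⟩ := encard_eq_two.1 h1
      have hs : X \ {x} ⊆ N.E := sdiff_subset.trans hX
      rw [heq] at hs hsub
      exact (pair_indep hN hE (hs (by simp)) (hs (by simp)) hab).subset hsub
  refine ⟨⟨hN, ?_⟩, ?_⟩
  · intro X Y hs
    have hX : X ⊆ N.E := hs.2.1 ▸ subset_union_left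
    have hY : Y ⊆ N.E := hs.2.1 ▸ subset_union_right
    rcases (h 3 (by norm_num) (by norm_num) X Y hs).2 with ⟨h1, h2⟩ | ⟨h1, h2⟩
    · exact Or.inl (tri X hX h1 h2)
    · exact Or.inr (Or.inr (Or.inl (tri Y hY h1 h2)))
  · rintro T ⟨hT, hT3⟩
    obtain ⟨hTE, f1, -⟩ := cocircuit_facts hT
    obtain ⟨e, he⟩ : T.Nonempty := by
      rw [← encard_ne_zero, hT3]; norm_num
    have hr : N.eRk (N.E \ T) + 1 ≤ N.eRk N.E := by
      rw [← eRk_insert_eq_add_one ⟨hTE he, f1 e he⟩]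
      exact N.eRk_mono (insert_subset (hTE he) sdiff_subset)
    have hc : (N.E \ T).encard + 3 = N.E.encard := by
      rw [← hT3]; exact encard_sdiff_add_encard_of_subset hTE
    have h4 : (4 : ℕ∞) ≤ (N.E \ T).encard := by
      by_contra hlt
      push Not at hlt
      have : (N.E \ T).encard + 3 ≤ 4 + 3 := by gcongr
      rw [hc] at this
      exact absurd (hE.trans this) (by norm_num)
    have hT3' : N.eRk T ≤ 3 := hT3 ▸ N.eRk_le_encard T
    have hsep : ∀ k : ℕ, 1 ≤ k → k < 4 → N.eRk T ≤ k → IsKSeparation N k T (N.E \ T) := by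
      intro k hk1 hk hrk
      rw [isKSep_iff]
      refine ⟨disjoint_sdiff_right, union_sdiff_cancel hTE, ?_, ?_, ?_⟩
      · obtain ⟨m, rfl⟩ : ∃ m, k = m + 1 := ⟨k - 1, by omega⟩
        calc _ ≤ ((m + 1 : ℕ) : ℕ∞) + N.eRk (N.E \ T) := by gcongr
          _ = (N.eRk (N.E \ T) + 1) + (m : ℕ∞) := by push_cast; ring
          _ ≤ N.eRk N.E + (m : ℕ∞) := by gcongr
          _ = _ := by simp
      · rw [hT3]; exact_mod_cast (by omega : k ≤ 3)
      · refine le_trans ?_ h4; exact_mod_cast (by omega : k ≤ 4)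
    rcases (h 3 (by norm_num) (by norm_num) _ _ (hsep 3 (by norm_num) (by norm_num)
      (by exact_mod_cast hT3'))).2 with ⟨-, h2⟩ | ⟨h1, -⟩
    · exact hN 2 (by norm_num) (by norm_num) _ _ (hsep 2 (by norm_num) (by norm_num)
        (by exact_mod_cast h2))
    · rw [h1] at h4; exact absurd h4 (by norm_num)

theorem stmt5 (M : Matroid α) (hI4 : InternallyFourConnected M) (hB : Binary M)
    (h3 : EveryElementInThreeTriangles M) (hE : (14 : ℕ∞) ≤ M.E.encard)
    (C : Set α) (hC : Cocircuit M C) (hC4 : C.encard = 4) :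
    ∀ e ∈ C, ∀ N, IsSimplificationOf N (contract M {e}) →
      InternallyFourConnected N ∧ ∀ T, ¬ IsTriad N T := by
  obtain ⟨φ, hφ⟩ := hB
  rintro e he N ⟨S, hSE, rfl, hSn, hSu⟩
  have hctr : contract M {e} = Matroid.contract M {e} := rfl
  rw [hctr] at hSE hSn hSu ⊢
  set Q := Matroid.contract M {e} with hQ
  have hE10 : (10 : ℕ∞) ≤ M.E.encard := le_trans (by norm_num) hE
  obtain ⟨hCE, f1, f2⟩ := cocircuit_facts hC
  have heE := hCE he
  set H := M.E \ C with hH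
  have hHE : H ⊆ M.E := sdiff_subset
  have hne : ∀ x ∈ H, x ≠ e := by rintro x hx rfl; exact hx.2 he
  have hHQ : H ⊆ Q.E := fun x hx => ⟨hHE hx, hne x hx⟩
  have hpair : ∀ x ∈ M.E, x ≠ e → M.Indep {e, x} := fun x hx hxe =>
    pair_indep hI4.1 hE10 heE hx (Ne.symm hxe)
  have heN : M.IsNonloop e := by
    obtain ⟨x, hx⟩ : H.Nonempty := by
      rw [nonempty_iff_ne_empty]; intro h0
      have := encard_sdiff_add_encard_of_subset hCE
      rw [← hH, h0, hC4, encard_empty] at this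
      rw [← this] at hE; exact absurd hE (by norm_num)
    exact indep_singleton.1 ((hpair x (hHE hx) (hne x hx)).subset (by simp))
  have hnl : ∀ x ∈ M.E, x ≠ e → Nonloop Q x := by
    intro x hx hxe
    unfold Nonloop
    rw [hQ, heN.contractElem_indep_iff]
    exact ⟨by simpa using hxe.symm, hpair x hx hxe⟩
  have hcl : ∀ X, Q.closure X = M.closure (insert e X) \ {e} := by
    intro X
    rw [hQ, contract_closure_eq, union_singleton]
  -- rank in the contraction of subsets of the hyperplane
  have hrk : ∀ A ⊆ H, Q.eRk A = M.eRk A := by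
    intro A hA
    obtain ⟨I, hI⟩ := M.exists_isBasis A (hA.trans hHE)
    have heI : e ∉ M.closure I := by
      rw [hI.closure_eq_closure]
      exact fun h => f1 e he (M.closure_subset_closure hA h)
    have heI' : e ∉ I := fun h => hne e (hA (hI.subset h)) rfl
    have hind : Q.Indep I := by
      rw [hQ, heN.contractElem_indep_iff]
      exact ⟨heI', ((hI.indep.notMem_closure_iff heE).1 heI).1⟩
    have hb : Q.closure A = Q.closure I := by
      rw [hcl, hcl, closure_insert_congr_right hI.closure_eq_closure]
    rw [← Q.eRk_closure_eq, hb, Q.eRk_closure_eq, hind.eRk_eq_encard, hI.eRk_eq_encard]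
  -- transversal map
  have hτ : ∀ h, h ∈ H → ∃ s, s ∈ S ∧ Q.closure {s} = Q.closure {h} := fun h hh =>
    (hSu h (hnl h (hHE hh) (hne h hh))).exists
  choose! τ hτS hτcl using hτ
  have hτinj : InjOn τ H := by
    intro x hx y hy hxy
    by_contra hne'
    have hi := pair_indep hI4.1 hE10 (hHE hx) (hHE hy) hne'
    have h1 : Q.closure {x} = Q.closure {y} := by
      rw [← hτcl x hx, ← hτcl y hy, hxy]
    have h2 : Q.eRk {x, y} ≤ 1 := by
      have : Q.closure {x, y} = Q.closure {y} := by
        apply closure_insert_eq_of_mem_closure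
        rw [← h1]
        exact Q.mem_closure_of_mem rfl (by simpa using hHQ hx)
      rw [← Q.eRk_closure_eq, this, Q.eRk_closure_eq]
      exact Q.eRk_singleton_le y
    rw [hrk _ (by intro z; simp; rintro (rfl | rfl) <;> assumption), hi.eRk_eq_encard,
      encard_pair hne'] at h2
    exact absurd h2 (by norm_num)
  have hτsurj : τ '' H = S := by
    apply subset_antisymm
    · rintro _ ⟨x, hx, rfl⟩; exact hτS x hx
    · intro s hs
      have hsQ := hSE hs
      have hsE : s ∈ M.E := hsQ.1
      have hse : s ≠ e := hsQ.2
      have main : ∃ x ∈ H, Q.closure {s} = Q.closure {x} := by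
        by_cases hsC : s ∈ C
        · obtain ⟨x, hx, hx'⟩ := four_cocircuit hφ hI4.1 hE10 h3 hC hC4 he hsC hse
          refine ⟨x, hx, ?_⟩
          have hxE := hHE hx
          rw [hcl, hcl]
          congr 1
          have e1 : x ∈ M.closure {e, s} := by
            rw [mem_cl hφ (by intro z; simp; rintro (rfl | rfl) <;> assumption) hxE, hx']
            exact Submodule.add_mem _ (Submodule.subset_span ⟨e, by simp, rfl⟩)
              (Submodule.subset_span ⟨s, by simp, rfl⟩)
          have e2 : s ∈ M.closure {e, x} := by
            rw [mem_cl hφ (by intro z; simp; rintro (rfl | rfl) <;> assumption) hsE]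
            have : φ s = φ e + φ x := by
              rw [hx', ← add_assoc, zmod2_add_self, zero_add]
            rw [this]
            exact Submodule.add_mem _ (Submodule.subset_span ⟨e, by simp, rfl⟩)
              (Submodule.subset_span ⟨x, by simp, rfl⟩)
          apply subset_antisymm
          · apply M.closure_subset_closure_of_subset_closure
            rintro z (rfl | rfl)
            · exact M.mem_closure_of_mem' (by simp) heE
            · exact e2
          · apply M.closure_subset_closure_of_subset_closure
            rintro z (rfl | rfl)
            · exact M.mem_closure_of_mem' (by simp) heE
            · exact e1
        · exact ⟨s, ⟨hsE, hsC⟩, rfl⟩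
      obtain ⟨x, hx, hsx⟩ := main
      refine ⟨x, hx, ?_⟩
      exact (hSu x (hnl x (hHE hx) (hne x hx))).unique ⟨hτS x hx, hτcl x hx⟩ ⟨hs, hsx⟩
  have hrkN : ∀ A ⊆ H, (Q ↾ S).eRk (τ '' A) = M.eRk A := by
    intro A hA
    rw [Q.restrict_eRk_eq (by rw [← hτsurj]; exact image_mono hA), ← hrk A hA,
      ← Q.eRk_closure_eq, ← Q.eRk_closure_eq A]
    congr 1
    apply subset_antisymm
    · apply Q.closure_subset_closure_of_subset_closure
      rintro _ ⟨x, hx, rfl⟩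
      apply Q.closure_subset_closure (singleton_subset_iff.2 hx)
      rw [← hτcl x (hA hx)]
      exact Q.mem_closure_of_mem' rfl (hSE (hτS x (hA hx)))
    · apply Q.closure_subset_closure_of_subset_closure
      intro x hx
      apply Q.closure_subset_closure (singleton_subset_iff.2 (mem_image_of_mem τ hx))
      rw [hτcl x (hA hx)]
      exact Q.mem_closure_of_mem' rfl (hHQ (hA hx))
  have hSc : S.encard = H.encard := by rw [← hτsurj, hτinj.encard_image]
  have hH10 : (10 : ℕ∞) ≤ H.encard := by
    have h1 := encard_sdiff_add_encard_of_subset hCE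
    rw [← hH, hC4] at h1
    rw [← h1] at hE
    by_contra hlt
    push Not at hlt
    have hfin : H.encard ≠ ⊤ := ne_top_of_lt hlt
    obtain ⟨n, hn⟩ := ENat.ne_top_iff_exists.1 hfin
    rw [← hn] at hE hlt
    have a1 : 14 ≤ n + 4 := by exact_mod_cast hE
    have a2 : n < 10 := by exact_mod_cast hlt
    omega
  apply finish (by rw [restrict_ground_eq, hSc]; exact hH10)
  intro k hk1 hk X Y hs
  rw [isKSep_iff, restrict_ground_eq] at hs
  obtain ⟨hd, hu, hr, hX, hY⟩ := hs
  have lift : ∀ X ⊆ S, ∃ A ⊆ H, τ '' A = X ∧ A = H ∩ τ ⁻¹' X := by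
    intro X hXS
    refine ⟨H ∩ τ ⁻¹' X, inter_subset_left, ?_, rfl⟩
    apply subset_antisymm
    · rintro _ ⟨x, hx, rfl⟩; exact hx.2
    · intro s hs
      obtain ⟨x, hx, rfl⟩ := hτsurj.symm ▸ hXS hs
      exact ⟨x, ⟨hx, hs⟩, rfl⟩
  obtain ⟨A, hA, rfl, hA'⟩ := lift X (hu ▸ subset_union_left)
  obtain ⟨B, hB, rfl, hB'⟩ := lift Y (hu ▸ subset_union_right)
  have hSr : (Q ↾ S).eRk S = M.eRk H := by
    rw [← hrkN H subset_rfl, hτsurj]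
  rw [hrkN A hA, hrkN B hB, hSr] at hr
  have cA : (τ '' A).encard = A.encard := (hτinj.mono hA).encard_image
  have cB : (τ '' B).encard = B.encard := (hτinj.mono hB).encard_image
  rw [cA] at hX
  rw [cB] at hY
  have hAB : Disjoint A B := by
    rw [Set.disjoint_left] at hd ⊢
    exact fun x hxA hxB => hd ⟨x, hxA, rfl⟩ ⟨x, hxB, rfl⟩
  have hABu : A ∪ B = M.E \ C := by
    apply subset_antisymm (union_subset hA hB)
    intro x hx
    have : τ x ∈ τ '' A ∪ τ '' B := hu ▸ hτS x hx
    rcases this with h | h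
    · left; rw [hA']; exact ⟨hx, h⟩
    · right; rw [hB']; exact ⟨hx, h⟩
  rw [hrkN A hA, hrkN B hB, cA, cB]
  exact core_s5 hφ hI4 hE10 h3 hC hC4 hk1 hk hAB hABu hr hX hY

end Paper
end
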